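/- For every n ≥ 1, the polynomial identity 3^n · n! · Σ_{σ ∈ SF_n} x^{risB(σ)} = (3n)! · Σ_{τ ∈ S_n} x^{ris(τ)} holds in ℤ[x], where S_n is the set of all bijections of {1,…,n}. -/

import Mathlib

/-- `SF n`: binary-shrub-forest permutations of size `n`, modeled as permutations of
`Fin (3*n)` (0-based; position `p` corresponds to 1-based position `p+1`):
for every `0 ≤ i ≤ n-1`, `σ(3i+1) < σ(3i+2)` and `σ(3i+1) < σ(3i+3)` (1-based). -/
def SF (n : ℕ) : Finset (Equiv.Perm (Fin (3*n))) :=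
  Finset.univ.filter fun σ =>
    ∀ i < n, ∃ h : 3*i+2 < 3*n,
      σ ⟨3*i, by omega⟩ < σ ⟨3*i+1, by omega⟩ ∧ σ ⟨3*i, by omega⟩ < σ ⟨3*i+2, h⟩

/-- 0-based shrub index `j` is a base rise (1-based rise index `i = j+1`):
`σ(3i-2) < σ(3i+1)` in 1-based terms. -/
def baseRise (n : ℕ) (σ : Equiv.Perm (Fin (3*n))) (j : ℕ) : Prop :=
  ∃ h : 3*j+3 < 3*n, σ ⟨3*j, by omega⟩ < σ ⟨3*j+3, h⟩

instance (n : ℕ) (σ : Equiv.Perm (Fin (3*n))) : DecidablePred (baseRise n σ) :=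
  fun _ => by unfold baseRise; infer_instance

/-- `risB σ`: the number of base rises of `σ`. -/
def risB (n : ℕ) (σ : Equiv.Perm (Fin (3*n))) : ℕ :=
  ((Finset.range n).filter (baseRise n σ)).card

/-- `IBF n`: the number of `σ ∈ SF n` for which every `i ∈ {1,…,n-1}` is a base rise. -/
def IBF (n : ℕ) : ℕ := ((SF n).filter fun σ => ∀ j < n - 1, baseRise n σ j).card

/-- `ris σ` = number of `j ∈ {1,…,m-1}` (1-based) with `σ(j) < σ(j+1)`. -/
def ris {m : ℕ} (σ : Equiv.Perm (Fin m)) : ℕ :=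
  ((Finset.range m).filter fun j => ∃ h : j + 1 < m, σ ⟨j, by omega⟩ < σ ⟨j+1, h⟩).card

/-- The position of the `p.2`-th vertex of the `p.1`-th shrub. -/
def shrubPos (n : ℕ) : Fin n × Fin 3 ≃ Fin (3 * n) :=
  finProdFinEquiv.trans (finCongr (Nat.mul_comm n 3))

theorem shrubPos_eq {n : ℕ} (i : Fin n) (j : Fin 3) (h : 3 * (i : ℕ) + j < 3 * n) :
    shrubPos n (i, j) = ⟨3 * i + j, h⟩ := by
  ext
  simp [shrubPos, add_comm]

theorem mem_SF_iff {n : ℕ} {σ : Equiv.Perm (Fin (3 * n))} :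
    σ ∈ SF n ↔ ∀ i j, σ (shrubPos n (i, 0)) ≤ σ (shrubPos n (i, j)) := by
  simp only [SF, Finset.mem_filter, Finset.mem_univ, true_and]
  constructor
  · intro h i j
    obtain ⟨h2, h01, h02⟩ := h i i.2
    rw [shrubPos_eq i 0 (by simp), shrubPos_eq i j (by omega)]
    fin_cases j
    · exact le_rfl
    · exact h01.le
    · exact h02.le
  · intro h i hi
    have key : ∀ j : Fin 3, j ≠ 0 →
        σ (shrubPos n (⟨i, hi⟩, 0)) < σ (shrubPos n (⟨i, hi⟩, j)) := fun j hj =>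
      lt_of_le_of_ne (h _ _) fun he => hj (by simpa using he.symm)
    refine ⟨by omega, ?_, ?_⟩
    · have := key 1 (by decide)
      rwa [shrubPos_eq _ 0 (by simp; omega), shrubPos_eq _ 1 (by simp; omega)] at this
    · have := key 2 (by decide)
      rwa [shrubPos_eq _ 0 (by simp; omega), shrubPos_eq _ 2 (by simp; omega)] at this

/-- The permutation of positions that rotates the `i`-th shrub by `f i`. -/
def shrubRotate {n : ℕ} (f : Fin n → Fin 3) : Equiv.Perm (Fin (3 * n)) :=
  (shrubPos n).permCongr (Equiv.prodShear (Equiv.refl _) fun i => Equiv.addRight (f i))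

@[simp]
theorem shrubRotate_shrubPos {n : ℕ} (f : Fin n → Fin 3) (i : Fin n) (j : Fin 3) :
    shrubRotate f (shrubPos n (i, j)) = shrubPos n (i, j + f i) := by
  simp [shrubRotate, Equiv.permCongr_apply]

/-- The permutation of positions that permutes the shrubs by `π`. -/
def shrubPermute {n : ℕ} (π : Equiv.Perm (Fin n)) : Equiv.Perm (Fin (3 * n)) :=
  (shrubPos n).permCongr (π.prodCongr (Equiv.refl _))

@[simp]
theorem shrubPermute_shrubPos {n : ℕ} (π : Equiv.Perm (Fin n)) (i : Fin n) (j : Fin 3) :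
    shrubPermute π (shrubPos n (i, j)) = shrubPos n (π i, j) := by
  simp [shrubPermute, Equiv.permCongr_apply]

theorem mul_shrubPermute_mem_SF_iff {n : ℕ} (σ : Equiv.Perm (Fin (3 * n)))
    (π : Equiv.Perm (Fin n)) : σ * shrubPermute π ∈ SF n ↔ σ ∈ SF n := by
  simp only [mem_SF_iff, Equiv.Perm.mul_apply, shrubPermute_shrubPos]
  exact π.forall_congr_left.trans (by simp)

theorem shrubRotate_neg {n : ℕ} (f : Fin n → Fin 3) :
    shrubRotate f * shrubRotate (-f) = 1 := by
  ext p
  obtain ⟨⟨i, j⟩, rfl⟩ := (shrubPos n).surjective p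
  simp

theorem three_pow_mul_card_SF (n : ℕ) : 3 ^ n * (SF n).card = (3 * n).factorial := by
  have hbij : Function.Bijective
      (fun x : (Fin n → Fin 3) × SF n => x.2.1 * shrubRotate x.1) := by
    constructor
    · rintro ⟨f, σ, hσ⟩ ⟨g, τ, hτ⟩ h
      dsimp only at h
      rw [mem_SF_iff] at hσ hτ
      have hval (i : Fin n) (j : Fin 3) :
          σ (shrubPos n (i, j + f i)) = τ (shrubPos n (i, j + g i)) := by
        simpa using DFunLike.congr_fun h (shrubPos n (i, j))
      have hfg : f = g := by
        ext1 i
        have h1 := hval i (-f i)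
        have h2 := hval i (-g i)
        rw [neg_add_cancel] at h1 h2
        have h3 := hσ i (-g i + f i)
        rw [h2] at h3
        have h4 := (hτ i (-f i + g i)).antisymm (h1 ▸ h3)
        have h5 : 0 = -f i + g i := by simpa using h4
        exact (neg_add_eq_zero.mp h5.symm)
      subst hfg
      simpa using h
    · intro ρ
      have hmin (i : Fin n) := Finite.exists_min fun j : Fin 3 => ρ (shrubPos n (i, j))
      choose a ha using hmin
      refine ⟨(-a, ⟨ρ * shrubRotate a, ?_⟩), ?_⟩
      · rw [mem_SF_iff]
        intro i j
        simpa using ha i _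
      · simp [mul_assoc, shrubRotate_neg]
  have := Fintype.card_of_bijective hbij
  simpa [Fintype.card_perm] using this

theorem risB_eq_ris {n : ℕ} {σ : Equiv.Perm (Fin (3 * n))} {τ : Equiv.Perm (Fin n)}
    (h : ∀ i j, τ i < τ j ↔ σ (shrubPos n (i, 0)) < σ (shrubPos n (j, 0))) :
    risB n σ = ris τ := by
  unfold risB ris
  congr 1
  refine Finset.filter_congr fun j _ => ?_
  have hiff (hj : j + 1 < n) : τ ⟨j, by omega⟩ < τ ⟨j + 1, hj⟩ ↔
      σ ⟨3 * j, by omega⟩ < σ ⟨3 * j + 3, by omega⟩ := by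
    rw [h, shrubPos_eq _ 0 (by simp; omega), shrubPos_eq _ 0 (by simp; omega)]
    rfl
  constructor
  · rintro ⟨hj, hlt⟩
    exact ⟨by omega, (hiff (by omega)).2 hlt⟩
  · rintro ⟨hj, hlt⟩
    exact ⟨by omega, (hiff hj).1 hlt⟩

theorem exists_perm_lt_iff {n : ℕ} {α : Type*} [LinearOrder α] {w : Fin n → α}
    (hw : Function.Injective w) : ∃ s : Equiv.Perm (Fin n), ∀ i j, s i < s j ↔ w i < w j := by
  have hmono : StrictMono (w ∘ Tuple.sort w) :=
    (Tuple.monotone_sort w).strictMono_of_injective (hw.comp (Tuple.sort w).injective)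
  refine ⟨(Tuple.sort w)⁻¹, fun i j => ?_⟩
  rw [← hmono.lt_iff_lt]
  simp

theorem sum_pow_risB_mul_shrubPermute {R : Type*} [CommSemiring R] (x : R) {n : ℕ}
    (σ : Equiv.Perm (Fin (3 * n))) :
    ∑ π : Equiv.Perm (Fin n), x ^ risB n (σ * shrubPermute π) =
      ∑ τ : Equiv.Perm (Fin n), x ^ ris τ := by
  obtain ⟨s, hs⟩ := exists_perm_lt_iff (w := fun i => σ (shrubPos n (i, 0)))
    fun i j h => by simpa using h
  refine Fintype.sum_equiv (Equiv.mulLeft s) _ _ fun π => ?_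
  congr 1
  exact risB_eq_ris fun i j => by simp [hs]

theorem factorial_mul_sum_pow_risB {R : Type*} [CommSemiring R] (x : R) (n : ℕ) :
    (n.factorial : R) * ∑ σ ∈ SF n, x ^ risB n σ =
      (SF n).card * ∑ τ : Equiv.Perm (Fin n), x ^ ris τ := by
  have hperm (π : Equiv.Perm (Fin n)) :
      ∑ σ ∈ SF n, x ^ risB n (σ * shrubPermute π) = ∑ σ ∈ SF n, x ^ risB n σ :=
    Finset.sum_equiv (Equiv.mulRight (shrubPermute π))
      (fun σ => (mul_shrubPermute_mem_SF_iff σ π).symm) fun _ _ => rfl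
  calc (n.factorial : R) * ∑ σ ∈ SF n, x ^ risB n σ
      = ∑ π : Equiv.Perm (Fin n), ∑ σ ∈ SF n, x ^ risB n (σ * shrubPermute π) := by
        simp [hperm, Fintype.card_perm]
    _ = ∑ σ ∈ SF n, ∑ π : Equiv.Perm (Fin n), x ^ risB n (σ * shrubPermute π) :=
        Finset.sum_comm
    _ = (SF n).card * ∑ τ : Equiv.Perm (Fin n), x ^ ris τ := by
        simp [sum_pow_risB_mul_shrubPermute]

theorem sum_risB_eq (n : ℕ) (hn : 1 ≤ n) :
    ((3 ^ n * n.factorial : ℕ) : Polynomial ℤ) *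
        ∑ σ ∈ SF n, (Polynomial.X : Polynomial ℤ) ^ risB n σ =
      (((3 * n).factorial : ℕ) : Polynomial ℤ) *
        ∑ τ : Equiv.Perm (Fin n), (Polynomial.X : Polynomial ℤ) ^ ris τ := by
  rw [← three_pow_mul_card_SF]
  push_cast
  rw [mul_assoc, factorial_mul_sum_pow_risB, mul_assoc]
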